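/- Let $(X,\mathcal{B}_X,\mu,T)$ be a $\mathbb{Z}^q$-MPS ($q\ge 2$) and $\vec v=(1,\beta_2,\dots,\beta_q)\in\mathbb{R}^q$ a direction vector. Then $\mu$ has $\vec v$-discrete spectrum if and only if $(X,\mathcal{B}_X,\mu,T)$ is $\vec v$-null. -/

import Mathlib

open MeasureTheory Filter Set
open scoped ENNReal Topology

namespace Directional

noncomputable section

attribute [local instance] Classical.propDecidable

variable {X : Type*} [MeasurableSpace X] {G : Type*}

/-- The set of Koopman images `U_T^w 1_B` for `w ∈ Λ`, as elements of `L²(μ)`. -/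
def korbit (μ : Measure X) (T : G → X → X) (Λ : Set G) (B : Set X) :
    Set (Lp ℝ 2 μ) :=
  {g | ∃ w ∈ Λ, (g : X → ℝ) =ᵐ[μ] fun x => B.indicator (fun _ => (1 : ℝ)) (T w x)}

/-- A finite measurable partition of `X`. -/
def IsPartition (α : Finset (Set X)) : Prop :=
  (∀ A ∈ α, MeasurableSet A) ∧ ((α : Set (Set X)).PairwiseDisjoint id) ∧
    ⋃₀ (α : Set (Set X)) = Set.univ

/-- Static entropy `H_μ(α) = -∑ μ(A) log μ(A)`. -/
def partEnt (μ : Measure X) (α : Finset (Set X)) : ℝ :=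
  ∑ A ∈ α, Real.negMulLog (μ A).toReal

/-- The join `⋁_{i=1}^k T^{-w_i} α`. -/
def seqJoin (T : G → X → X) (w : ℕ → G) (α : Finset (Set X)) : ℕ → Finset (Set X)
  | 0 => {Set.univ}
  | k + 1 => ((seqJoin T w α k) ×ˢ α).image fun p => p.1 ∩ (T (w k) ⁻¹' p.2)

/-- Sequence entropy `h^S_μ(T, α)` along the sequence `w` for the partition `α`. -/
def seqEnt (μ : Measure X) (T : G → X → X) (w : ℕ → G) (α : Finset (Set X)) : ℝ :=
  Filter.atTop.limsup fun k : ℕ => partEnt μ (seqJoin T w α k) / (k : ℝ)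

/-- Sequence entropy `h^S_μ(T)`, as the supremum over all finite measurable
partitions (valued in `ℝ≥0∞`). -/
def seqEntSup (μ : Measure X) (T : G → X → X) (w : ℕ → G) : ℝ≥0∞ :=
  ⨆ α : {α : Finset (Set X) // IsPartition α}, ENNReal.ofReal (seqEnt μ T w α)

/-- `w : ℕ → G` is an enumeration of an infinite subset of `Λ`. -/
def EnumIn (w : ℕ → G) (Λ : Set G) : Prop :=
  Function.Injective w ∧ ∀ i, w i ∈ Λ

/-- Conditional entropy `H_μ(α | F)` with respect to a sub-σ-algebra `F`. -/
def condEntAlg (μ : Measure X) (F : MeasurableSpace X) (α : Finset (Set X)) : ℝ :=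
  ∑ A ∈ α, ∫ x, Real.negMulLog ((μ[A.indicator (fun _ => (1 : ℝ)) | F]) x) ∂μ

/-- Conditional entropy `H_μ(α | η)` of a partition given another partition. -/
def condEntPart (μ : Measure X) (α η : Finset (Set X)) : ℝ :=
  -∑ A ∈ α, ∑ D ∈ η,
    (μ (A ∩ D)).toReal * Real.log ((μ (A ∩ D)).toReal / (μ D).toReal)

/-- A `ℤ²`-measure-preserving system: an action of `ℤ²` by homeomorphisms
(continuous maps with continuous inverses `T (-w)`), preserving `μ`. -/
def IsZ2MPS [TopologicalSpace X] (μ : Measure X) (T : ℤ × ℤ → X → X) : Prop :=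
  (∀ w, Continuous (T w)) ∧ T 0 = _root_.id ∧ (∀ v w, T (v + w) = T v ∘ T w) ∧
    ∀ w, MeasurePreserving (T w) μ μ

/-- The strip `Λ^{(1,β)}(b) = {(m,n) : βm - b/2 ≤ n ≤ βm + b/2}`. -/
def Lam (β b : ℝ) : Set (ℤ × ℤ) :=
  {p | β * (p.1 : ℝ) - b / 2 ≤ (p.2 : ℝ) ∧ (p.2 : ℝ) ≤ β * (p.1 : ℝ) + b / 2}

/-- The `(1,β)`-directional Kronecker algebra with width parameter `b`. -/
def dirKron (μ : Measure X) (T : ℤ × ℤ → X → X) (β b : ℝ) : Set (Set X) :=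
  {B | MeasurableSet B ∧ IsCompact (closure (korbit μ T (Lam β b) B))}

/-- The directional Kronecker algebra as a σ-algebra (using width `b = 1`,
which is immaterial since `dirKron` is independent of `b`). -/
def dirKronAlg (μ : Measure X) (T : ℤ × ℤ → X → X) (β : ℝ) : MeasurableSpace X :=
  MeasurableSpace.generateFrom (dirKron μ T β 1)

/-- The classical Kronecker algebra of the `ℤ²`-system. -/
def kron (μ : Measure X) (T : ℤ × ℤ → X → X) : Set (Set X) :=
  {B | MeasurableSet B ∧ IsCompact (closure (korbit μ T Set.univ B))}

/-- `h^{v,*}_μ(α)`: supremum of directional sequence entropies of `α` over all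
infinite subsets of the strip (width `1`, immaterial). -/
def hStar (μ : Measure X) (T : ℤ × ℤ → X → X) (β : ℝ) (α : Finset (Set X)) : ℝ :=
  ⨆ w : {w : ℕ → ℤ × ℤ // EnumIn w (Lam β 1)}, seqEnt μ T w.1 α

/-- The two-element partition `{B, Bᶜ}`. -/
def pairPart (B : Set X) : Finset (Set X) := {B, Bᶜ}

/-- The pulled-back partition `T^{-g} α = {T_g⁻¹ A : A ∈ α}`. -/
def pullPart (T : G → X → X) (g : G) (α : Finset (Set X)) : Finset (Set X) :=
  α.image fun A => T g ⁻¹' A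

end

section Zq

variable {X : Type*} [MeasurableSpace X] {q : ℕ} [NeZero q]

/-- A `ℤ^q`-measure-preserving system: an action of `ℤ^q` by homeomorphisms
preserving `μ`. -/
def IsZqMPS [TopologicalSpace X] (μ : Measure X) (T : (Fin q → ℤ) → X → X) : Prop :=
  (∀ w, Continuous (T w)) ∧ T 0 = _root_.id ∧ (∀ v w, T (v + w) = T v ∘ T w) ∧
    ∀ w, MeasurePreserving (T w) μ μ

/-- The tube `Λ^{(1,β₂,…,β_q)}(b) ⊆ ℤ^q`. -/
def LamQ (β b : Fin q → ℝ) : Set (Fin q → ℤ) :=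
  {w | ∀ i : Fin q, i ≠ 0 →
    (β i * (w 0 : ℝ) - b i / 2 ≤ (w i : ℝ) ∧ (w i : ℝ) ≤ β i * (w 0 : ℝ) + b i / 2)}

/-- The directional Kronecker algebra of a `ℤ^q`-system along `(1,β₂,…,β_q)`
with width parameter `b`. -/
def dirKronQ (μ : Measure X) (T : (Fin q → ℤ) → X → X) (β b : Fin q → ℝ) :
    Set (Set X) :=
  {B | MeasurableSet B ∧ IsCompact (closure (korbit μ T (LamQ β b) B))}

/-- The directional Kronecker algebra as a σ-algebra (width `1`, immaterial). -/
def dirKronAlgQ (μ : Measure X) (T : (Fin q → ℤ) → X → X) (β : Fin q → ℝ) :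
    MeasurableSpace X :=
  MeasurableSpace.generateFrom (dirKronQ μ T β fun _ => 1)

/-- The classical Kronecker algebra of a `ℤ^q`-system. -/
def kronQ (μ : Measure X) (T : (Fin q → ℤ) → X → X) : Set (Set X) :=
  {B | MeasurableSet B ∧ IsCompact (closure (korbit μ T Set.univ B))}

/-- `h^{v,*}_μ(α)` for a `ℤ^q`-system: the supremum of directional sequence
entropies of `α` over all infinite subsets of the tube (width `1`,
immaterial). -/
noncomputable def hStarQ (μ : Measure X) (T : (Fin q → ℤ) → X → X) (β : Fin q → ℝ)
    (α : Finset (Set X)) : ℝ :=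
  ⨆ w : {w : ℕ → Fin q → ℤ // EnumIn w (LamQ β fun _ => 1)}, seqEnt μ T w.1 α

end Zq

section Entropy

attribute [local instance] Classical.propDecidable

variable {X : Type*} [MeasurableSpace X]

/-- The refinement `P ∨ S⁻¹ α` of the partition `P`. -/
noncomputable def refineBy (S : X → X) (P α : Finset (Set X)) : Finset (Set X) :=
  (P ×ˢ α).image fun p => p.1 ∩ (S ⁻¹' p.2)

/-- Gibbs' inequality for unnormalised weights. -/
lemma sum_negMulLog_le {ι : Type*} (s : Finset ι) (m p : ι → ℝ) (M : ℝ)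
    (hm : ∀ i ∈ s, 0 ≤ m i) (hp : ∀ i ∈ s, 0 < p i) (hM : ∑ i ∈ s, m i = M) :
    ∑ i ∈ s, Real.negMulLog (m i) ≤
      Real.negMulLog M - ∑ i ∈ s, m i * Real.log (p i) + M * (∑ i ∈ s, p i - 1) := by
  have key : ∀ i ∈ s, Real.negMulLog (m i) + m i * Real.log M + m i * Real.log (p i)
      ≤ M * p i - m i := by
    intro i hi
    have hle : m i ≤ M := hM ▸ Finset.single_le_sum hm hi
    rcases (hm i hi).eq_or_lt with h0 | h0
    · have : 0 ≤ M * p i := mul_nonneg ((hm i hi).trans hle) (hp i hi).le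
      simpa [← h0] using this
    · have hMpos : 0 < M := h0.trans_le hle
      have hlog := Real.log_le_sub_one_of_pos (div_pos (mul_pos hMpos (hp i hi)) h0)
      rw [Real.log_div (mul_pos hMpos (hp i hi)).ne' h0.ne',
        Real.log_mul hMpos.ne' (hp i hi).ne'] at hlog
      have h2 := mul_le_mul_of_nonneg_left hlog h0.le
      have h3 : m i * (M * p i / m i - 1) = M * p i - m i := by field_simp
      rw [h3] at h2
      unfold Real.negMulLog
      linarith
  have h := Finset.sum_le_sum key
  simp only [Finset.sum_add_distrib, Finset.sum_sub_distrib, ← Finset.sum_mul,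
    ← Finset.mul_sum, hM] at h
  unfold Real.negMulLog at *
  linarith

/-- Entropy of a distribution of total mass `M` dominates its (normalised) Gini impurity. -/
lemma sub_sq_div_le_sum_negMulLog {ι : Type*} (s : Finset ι) (m : ι → ℝ) (M : ℝ)
    (hm : ∀ i ∈ s, 0 ≤ m i) (hM : ∑ i ∈ s, m i = M) {j : ι} (hj : j ∈ s) :
    Real.negMulLog M + (m j - m j ^ 2 / M) ≤ ∑ i ∈ s, Real.negMulLog (m i) := by
  have key : ∀ i ∈ s, m i - m i ^ 2 / M ≤ Real.negMulLog (m i) + m i * Real.log M := by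
    intro i hi
    have hle : m i ≤ M := hM ▸ Finset.single_le_sum hm hi
    rcases (hm i hi).eq_or_lt with h0 | h0
    · simp [← h0]
    · have hMpos : 0 < M := h0.trans_le hle
      have hlog := Real.log_le_sub_one_of_pos (div_pos h0 hMpos)
      rw [Real.log_div h0.ne' hMpos.ne'] at hlog
      have h2 := mul_le_mul_of_nonneg_left hlog h0.le
      have h3 : m i * (m i / M - 1) = m i ^ 2 / M - m i := by field_simp
      rw [h3] at h2
      unfold Real.negMulLog
      linarith
  have hnn : ∀ i ∈ s, 0 ≤ m i - m i ^ 2 / M := by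
    intro i hi
    have hle : m i ≤ M := hM ▸ Finset.single_le_sum hm hi
    have : m i ^ 2 / M ≤ m i := by
      apply div_le_of_le_mul₀ ((hm i hi).trans hle) (hm i hi)
      rw [sq]
      exact mul_le_mul_of_nonneg_left hle (hm i hi)
    linarith
  have h1 := Finset.single_le_sum hnn hj
  have h := h1.trans (Finset.sum_le_sum key)
  simp only [Finset.sum_add_distrib, ← Finset.sum_mul, hM] at h
  have : Real.negMulLog M = -(M * Real.log M) := by unfold Real.negMulLog; ring
  linarith

lemma IsPartition.refineBy {S : X → X} (hS : Measurable S) {P α : Finset (Set X)}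
    (hP : IsPartition P) (hα : IsPartition α) : IsPartition (refineBy S P α) := by
  obtain ⟨hPm, hPd, hPc⟩ := hP
  obtain ⟨hαm, hαd, hαc⟩ := hα
  refine ⟨?_, ?_, ?_⟩
  · intro A hA
    obtain ⟨p, hp, rfl⟩ := Finset.mem_image.1 hA
    rw [Finset.mem_product] at hp
    exact (hPm _ hp.1).inter (hS (hαm _ hp.2))
  · intro A hA B hB hAB
    obtain ⟨⟨a, b⟩, hp, rfl⟩ := Finset.mem_image.1 hA
    obtain ⟨⟨c, d⟩, hr, rfl⟩ := Finset.mem_image.1 hB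
    rw [Finset.mem_product] at hp hr
    by_cases h : a = c
    · have hbd : b ≠ d := by rintro rfl; exact hAB (by simp [h])
      exact ((hαd hp.2 hr.2 hbd).preimage S).mono inter_subset_right inter_subset_right
    · exact (hPd hp.1 hr.1 h).mono inter_subset_left inter_subset_left
  · refine eq_univ_of_forall fun x => ?_
    obtain ⟨D, hD, hxD⟩ : x ∈ ⋃₀ (P : Set (Set X)) := hPc ▸ mem_univ x
    obtain ⟨A, hA, hxA⟩ : S x ∈ ⋃₀ (α : Set (Set X)) := hαc ▸ mem_univ (S x)
    exact ⟨D ∩ S ⁻¹' A, Finset.mem_image.2 ⟨(D, A), Finset.mem_product.2 ⟨hD, hA⟩, rfl⟩,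
      hxD, hxA⟩

lemma IsPartition.sum_measureReal_inter_preimage (μ : Measure X) [IsFiniteMeasure μ]
    {S : X → X} (hS : Measurable S) {α : Finset (Set X)} (hα : IsPartition α) {D : Set X}
    (hD : MeasurableSet D) : ∑ A ∈ α, μ.real (D ∩ S ⁻¹' A) = μ.real D := by
  obtain ⟨hαm, hαd, hαc⟩ := hα
  rw [← measureReal_biUnion_finset]
  · congr 1
    ext x
    simp only [mem_iUnion, mem_inter_iff, mem_preimage, exists_prop]
    constructor
    · rintro ⟨A, -, h, -⟩; exact h
    · intro h
      obtain ⟨A, hA, hxA⟩ : S x ∈ ⋃₀ (α : Set (Set X)) := hαc ▸ mem_univ (S x)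
      exact ⟨A, hA, h, hxA⟩
  · intro A hA B hB hAB
    exact ((hαd hA hB hAB).preimage S).mono inter_subset_right inter_subset_right
  · intro A hA
    exact hD.inter (hS (hαm A hA))

lemma IsPartition.sum_measureReal_inter (μ : Measure X) [IsFiniteMeasure μ]
    {P : Finset (Set X)} (hP : IsPartition P) {E : Set X}
    (hE : MeasurableSet E) : ∑ D ∈ P, μ.real (D ∩ E) = μ.real E := by
  rw [← hP.sum_measureReal_inter_preimage μ measurable_id hE]
  simp [inter_comm]

lemma IsPartition.sum_measureReal (μ : Measure X) [IsProbabilityMeasure μ]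
    {P : Finset (Set X)} (hP : IsPartition P) : ∑ D ∈ P, μ.real D = 1 := by
  simpa using hP.sum_measureReal_inter μ MeasurableSet.univ

lemma partEnt_refineBy (μ : Measure X) (S : X → X) {P α : Finset (Set X)}
    (hP : IsPartition P) (hα : IsPartition α) :
    partEnt μ (refineBy S P α) =
      ∑ D ∈ P, ∑ A ∈ α, Real.negMulLog (μ.real (D ∩ S ⁻¹' A)) := by
  unfold partEnt refineBy
  rw [Finset.sum_image_of_pairwise_eq_zero, Finset.sum_product]
  · rfl
  rintro ⟨a, b⟩ hp ⟨c, d⟩ hr hne heq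
  rw [Finset.mem_coe, Finset.mem_product] at hp hr
  have hempty : a ∩ S ⁻¹' b = ∅ := by
    by_contra h
    obtain ⟨x, hx⟩ := nonempty_iff_ne_empty.2 h
    have hx' : x ∈ c ∩ S ⁻¹' d := heq ▸ hx
    have h1 : a = c := hP.2.1.elim hp.1 hr.1 (not_disjoint_iff.2 ⟨x, hx.1, hx'.1⟩)
    have h2 : b = d := hα.2.1.elim hp.2 hr.2 (not_disjoint_iff.2 ⟨S x, hx.2, hx'.2⟩)
    exact hne (by rw [h1, h2])
  simp [hempty]

lemma partEnt_refineBy_le_add_log_card (μ : Measure X) [IsProbabilityMeasure μ] {S : X → X}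
    (hS : Measurable S) {P α : Finset (Set X)} (hP : IsPartition P) (hα : IsPartition α) :
    partEnt μ (refineBy S P α) ≤ partEnt μ P + Real.log α.card := by
  rw [partEnt_refineBy μ S hP hα]
  have hne : α.Nonempty := by
    by_contra h
    rw [Finset.not_nonempty_iff_eq_empty] at h
    obtain ⟨x⟩ := nonempty_of_isProbabilityMeasure μ
    obtain ⟨A, hA, -⟩ : x ∈ ⋃₀ (α : Set (Set X)) := hα.2.2 ▸ mem_univ x
    simp [h] at hA
  have hc : (0 : ℝ) < α.card := by exact_mod_cast hne.card_pos
  have key : ∀ D ∈ P, ∑ A ∈ α, Real.negMulLog (μ.real (D ∩ S ⁻¹' A)) ≤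
      Real.negMulLog (μ.real D) + μ.real D * Real.log α.card := by
    intro D hD
    have hsum := hα.sum_measureReal_inter_preimage μ hS (hP.1 D hD)
    have h := sum_negMulLog_le α (fun A => μ.real (D ∩ S ⁻¹' A)) (fun _ => (α.card : ℝ)⁻¹)
      (μ.real D) (fun _ _ => measureReal_nonneg) (fun _ _ => inv_pos.2 hc) hsum
    rw [← Finset.sum_mul, hsum] at h
    simp only [Finset.sum_const, nsmul_eq_mul, mul_inv_cancel₀ hc.ne', Real.log_inv] at h
    linarith
  refine (Finset.sum_le_sum key).trans ?_
  rw [Finset.sum_add_distrib, ← Finset.sum_mul, hP.sum_measureReal μ, one_mul]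
  rfl

lemma partEnt_add_le_partEnt_refineBy (μ : Measure X) [IsProbabilityMeasure μ] {S : X → X}
    (hS : Measurable S) {P α : Finset (Set X)} (hP : IsPartition P) (hα : IsPartition α)
    {A : Set X} (hA : A ∈ α) :
    partEnt μ P + ∑ D ∈ P, (μ.real (D ∩ S ⁻¹' A) - μ.real (D ∩ S ⁻¹' A) ^ 2 / μ.real D) ≤
      partEnt μ (refineBy S P α) := by
  rw [partEnt_refineBy μ S hP hα, partEnt, ← Finset.sum_add_distrib]
  refine Finset.sum_le_sum fun D hD => ?_
  exact sub_sq_div_le_sum_negMulLog α (fun A => μ.real (D ∩ S ⁻¹' A)) (μ.real D)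
    (fun _ _ => measureReal_nonneg) (hα.sum_measureReal_inter_preimage μ hS (hP.1 D hD)) hA

/-- Refining `P` by `S⁻¹ α` costs little entropy if `P` already refines a nearby `R⁻¹ α`. -/
lemma partEnt_refineBy_le_of_close (μ : Measure X) [IsProbabilityMeasure μ] {S R : X → X}
    (hS : Measurable S) (hR : Measurable R) {P α : Finset (Set X)} (hP : IsPartition P)
    (hα : IsPartition α) (hPR : ∀ D ∈ P, ∃ A ∈ α, D ⊆ R ⁻¹' A) {δ θ : ℝ}
    (hδ : ∀ A ∈ α, μ.real (R ⁻¹' A \ S ⁻¹' A) ≤ δ) (hθ0 : 0 < θ) (hθ1 : θ ≤ 1) :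
    partEnt μ (refineBy S P α) ≤
      partEnt μ P + α.card * (δ * (-Real.log θ) + θ) := by
  rw [partEnt_refineBy μ S hP hα]
  choose! lab hlab hsub using hPR
  have hlog : 0 ≤ -Real.log θ := neg_nonneg.2 (Real.log_nonpos hθ0.le hθ1)
  have key : ∀ D ∈ P, ∑ A ∈ α, Real.negMulLog (μ.real (D ∩ S ⁻¹' A)) ≤
      Real.negMulLog (μ.real D) + (∑ A ∈ α, μ.real (D ∩ (R ⁻¹' A \ S ⁻¹' A))) * (-Real.log θ)
        + μ.real D * (α.card * θ) := by
    intro D hD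
    have hsum := hα.sum_measureReal_inter_preimage μ hS (hP.1 D hD)
    have h := sum_negMulLog_le α (fun A => μ.real (D ∩ S ⁻¹' A))
      (fun A => if A = lab D then 1 else θ) (μ.real D) (fun _ _ => measureReal_nonneg)
      (fun A _ => by split_ifs <;> linarith) hsum
    have h1 : ∑ A ∈ α, (if A = lab D then (1 : ℝ) else θ) - 1 ≤ α.card * θ := by
      have : ∀ A ∈ α, (if A = lab D then (1 : ℝ) else θ) ≤ (if A = lab D then 1 else 0) + θ := by
        intro A _
        split_ifs <;> linarith
      have h2 := Finset.sum_le_sum this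
      rw [Finset.sum_add_distrib, Finset.sum_ite_eq' α (lab D), if_pos (hlab D hD)] at h2
      simp only [Finset.sum_const, nsmul_eq_mul] at h2
      linarith
    have h2 : -∑ A ∈ α, μ.real (D ∩ S ⁻¹' A) * Real.log (if A = lab D then (1 : ℝ) else θ) =
        (μ.real D - μ.real (D ∩ S ⁻¹' lab D)) * (-Real.log θ) := by
      have : ∀ A ∈ α, μ.real (D ∩ S ⁻¹' A) * Real.log (if A = lab D then (1 : ℝ) else θ) =
          (μ.real (D ∩ S ⁻¹' A) - if A = lab D then μ.real (D ∩ S ⁻¹' A) else 0)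
            * Real.log θ := by
        intro A _
        split_ifs <;> simp
      rw [Finset.sum_congr rfl this, ← Finset.sum_mul, Finset.sum_sub_distrib, hsum,
        Finset.sum_ite_eq' α (lab D), if_pos (hlab D hD)]
      ring
    have h3 : μ.real D - μ.real (D ∩ S ⁻¹' lab D) ≤
        ∑ A ∈ α, μ.real (D ∩ (R ⁻¹' A \ S ⁻¹' A)) := by
      refine le_trans ?_ (Finset.single_le_sum
        (f := fun A => μ.real (D ∩ (R ⁻¹' A \ S ⁻¹' A)))
        (fun _ _ => measureReal_nonneg) (hlab D hD))
      have heq : D ∩ (R ⁻¹' lab D \ S ⁻¹' lab D) = D \ S ⁻¹' lab D := by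
        rw [← inter_sdiff_assoc, inter_eq_left.2 (hsub D hD)]
      have := measureReal_inter_add_sdiff (μ := μ) (s := D) (hS (hα.1 _ (hlab D hD)))
      simp only [heq]
      linarith
    have h4 := mul_le_mul_of_nonneg_right h3 hlog
    have h5 := mul_le_mul_of_nonneg_left h1 (measureReal_nonneg (μ := μ) (s := D))
    linarith
  refine (Finset.sum_le_sum key).trans ?_
  have htot : ∑ D ∈ P, ∑ A ∈ α, μ.real (D ∩ (R ⁻¹' A \ S ⁻¹' A)) ≤ α.card * δ := by
    rw [Finset.sum_comm]
    have : ∀ A ∈ α, ∑ D ∈ P, μ.real (D ∩ (R ⁻¹' A \ S ⁻¹' A)) ≤ δ := fun A hA => by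
      rw [hP.sum_measureReal_inter μ ((hR (hα.1 A hA)).diff (hS (hα.1 A hA)))]
      exact hδ A hA
    simpa using Finset.sum_le_sum this
  have h4 := mul_le_mul_of_nonneg_right htot hlog
  rw [Finset.sum_add_distrib, Finset.sum_add_distrib, ← Finset.sum_mul, ← Finset.sum_mul,
    hP.sum_measureReal μ, one_mul]
  unfold partEnt Measure.real at *
  linarith

variable {G : Type*}

lemma isPartition_singleton_univ : IsPartition ({univ} : Finset (Set X)) :=
  ⟨by simp, by simp, by simp⟩

lemma isPartition_pairPart {B : Set X} (hB : MeasurableSet B) : IsPartition (pairPart B) := by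
  refine ⟨?_, ?_, ?_⟩
  · simp [pairPart, hB]
  · intro A hA C hC hAC
    simp only [pairPart, Finset.coe_insert, Finset.coe_singleton, mem_insert_iff,
      mem_singleton_iff] at hA hC
    rcases hA with rfl | rfl <;> rcases hC with rfl | rfl
    · exact absurd rfl hAC
    · exact disjoint_compl_right
    · exact disjoint_compl_left
    · exact absurd rfl hAC
  · simp [pairPart]

lemma seqJoin_succ {Y : Type*} (T : G → Y → Y) (w : ℕ → G) (α : Finset (Set Y)) (k : ℕ) :
    seqJoin T w α (k + 1) = refineBy (T (w k)) (seqJoin T w α k) α := rfl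

lemma isPartition_seqJoin {T : G → X → X} (hT : ∀ g, Measurable (T g)) (w : ℕ → G)
    {α : Finset (Set X)} (hα : IsPartition α) (k : ℕ) : IsPartition (seqJoin T w α k) := by
  induction k with
  | zero => exact isPartition_singleton_univ
  | succ k ih => exact ih.refineBy (hT _) hα

lemma exists_subset_of_mem_seqJoin {Y : Type*} (T : G → Y → Y) (w : ℕ → G)
    (α : Finset (Set Y)) {j k : ℕ} (hjk : j < k) : ∀ D ∈ seqJoin T w α k, ∃ A ∈ α, D ⊆ T (w j) ⁻¹' A := by
  induction k with
  | zero => omega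
  | succ k ih =>
    intro D hD
    rw [seqJoin_succ] at hD
    obtain ⟨⟨E, A⟩, hp, rfl⟩ := Finset.mem_image.1 hD
    rw [Finset.mem_product] at hp
    rcases Nat.lt_succ_iff_lt_or_eq.1 hjk with h | rfl
    · obtain ⟨C, hC, hsub⟩ := ih h E hp.1
      exact ⟨C, hC, inter_subset_left.trans hsub⟩
    · exact ⟨A, hp.2, inter_subset_right⟩

lemma partEnt_nonneg (μ : Measure X) [IsProbabilityMeasure μ] (α : Finset (Set X)) :
    0 ≤ partEnt μ α :=
  Finset.sum_nonneg fun _ _ => Real.negMulLog_nonneg measureReal_nonneg measureReal_le_one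

lemma partEnt_seqJoin_zero (μ : Measure X) [IsProbabilityMeasure μ] (T : G → X → X)
    (w : ℕ → G) (α : Finset (Set X)) : partEnt μ (seqJoin T w α 0) = 0 := by
  simp [seqJoin, partEnt]

lemma partEnt_seqJoin_le (μ : Measure X) [IsProbabilityMeasure μ] {T : G → X → X}
    (hT : ∀ g, Measurable (T g)) (w : ℕ → G) {α : Finset (Set X)} (hα : IsPartition α) (k : ℕ) :
    partEnt μ (seqJoin T w α k) ≤ k * Real.log α.card := by
  induction k with
  | zero => simp [partEnt_seqJoin_zero]
  | succ k ih =>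
    have := partEnt_refineBy_le_add_log_card μ (hT (w k)) (isPartition_seqJoin hT w hα k) hα
    rw [seqJoin_succ]
    push_cast
    linarith

lemma le_seqEnt (μ : Measure X) [IsProbabilityMeasure μ] {T : G → X → X}
    (hT : ∀ g, Measurable (T g)) (w : ℕ → G) {α : Finset (Set X)} (hα : IsPartition α) {c : ℝ}
    (h : ∀ k : ℕ, k * c ≤ partEnt μ (seqJoin T w α k)) : c ≤ seqEnt μ T w α := by
  refine le_limsup_of_frequently_le (Eventually.frequently ?_) ?_
  · filter_upwards [eventually_gt_atTop 0] with k hk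
    rw [le_div_iff₀ (by exact_mod_cast hk), mul_comm]
    exact h k
  · refine isBoundedUnder_of_eventually_le (a := Real.log α.card) ?_
    filter_upwards [eventually_gt_atTop 0] with k hk
    rw [div_le_iff₀ (by exact_mod_cast hk), mul_comm]
    exact partEnt_seqJoin_le μ hT w hα k

lemma seqEnt_le (μ : Measure X) [IsProbabilityMeasure μ] {T : G → X → X} (w : ℕ → G)
    {α : Finset (Set X)} {c C : ℝ} (hc : 0 < c)
    (h : ∀ k : ℕ, partEnt μ (seqJoin T w α k) ≤ C + k * c) : seqEnt μ T w α ≤ 2 * c := by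
  refine limsup_le_of_le ?_ ?_
  · exact isCoboundedUnder_le_of_le atTop (x := 0)
      fun k => div_nonneg (partEnt_nonneg μ _) (Nat.cast_nonneg k)
  · filter_upwards [eventually_gt_atTop 0, eventually_ge_atTop ⌈C / c⌉₊] with k hk hk2
    rw [div_le_iff₀ (by exact_mod_cast hk)]
    have h1 : C / c ≤ k := (Nat.le_ceil _).trans (by exact_mod_cast hk2)
    rw [div_le_iff₀ hc] at h1
    have := h k
    linarith

/-- If, for every scale, the pullbacks `T_{w i}⁻¹ α` take only finitely many values up to
small error, then `α` has zero sequence entropy along `w`. -/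
lemma seqEnt_nonpos_of_coloring (μ : Measure X) [IsProbabilityMeasure μ] {T : G → X → X}
    (hT : ∀ g, Measurable (T g)) (w : ℕ → G) {α : Finset (Set X)} (hα : IsPartition α)
    (hcol : ∀ δ : ℝ, 0 < δ → ∃ (N : ℕ) (c : ℕ → Fin N), ∀ i j, c i = c j →
      ∀ A ∈ α, μ.real (T (w j) ⁻¹' A \ T (w i) ⁻¹' A) ≤ δ) :
    seqEnt μ T w α ≤ 0 := by
  refine le_of_forall_pos_le_add fun ε hε => ?_
  set n : ℝ := (α.card : ℝ) with hn
  have hn0 : 0 ≤ n := Nat.cast_nonneg _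
  obtain ⟨θ, hθ0, hθ1, hθ⟩ : ∃ θ : ℝ, 0 < θ ∧ θ ≤ 1 ∧ n * θ ≤ ε / 4 := by
    refine ⟨min 1 (ε / (4 * (n + 1))), by positivity, min_le_left _ _, ?_⟩
    have h1 : min 1 (ε / (4 * (n + 1))) ≤ ε / (4 * (n + 1)) := min_le_right _ _
    have h2 : n * (ε / (4 * (n + 1))) ≤ ε / 4 := by
      rw [mul_div_assoc', div_le_div_iff₀ (by positivity) (by positivity)]
      nlinarith
    exact (mul_le_mul_of_nonneg_left h1 hn0).trans h2
  have hlog : 0 ≤ -Real.log θ := neg_nonneg.2 (Real.log_nonpos hθ0.le hθ1)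
  obtain ⟨δ, hδ0, hδ⟩ : ∃ δ : ℝ, 0 < δ ∧ n * (δ * (-Real.log θ)) ≤ ε / 4 := by
    have hpos : 0 < 4 * (n * (-Real.log θ) + 1) := by positivity
    refine ⟨ε / (4 * (n * (-Real.log θ) + 1)), by positivity, ?_⟩
    have : n * (ε / (4 * (n * (-Real.log θ) + 1)) * (-Real.log θ)) =
        (ε * (n * (-Real.log θ))) / (4 * (n * (-Real.log θ) + 1)) := by ring
    rw [this, div_le_div_iff₀ hpos (by positivity)]
    nlinarith
  obtain ⟨N, c, hc⟩ := hcol δ hδ0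
  have hstep : ∀ k : ℕ, partEnt μ (seqJoin T w α k) ≤
      (((Finset.range k).image c).card : ℝ) * Real.log n + k * (ε / 2) := by
    intro k
    induction k with
    | zero => simp [partEnt_seqJoin_zero]
    | succ k ih =>
      rw [seqJoin_succ, Finset.range_add_one, Finset.image_insert]
      by_cases hk : c k ∈ (Finset.range k).image c
      · rw [Finset.insert_eq_of_mem hk]
        obtain ⟨j, hj, hcj⟩ := Finset.mem_image.1 hk
        have := partEnt_refineBy_le_of_close μ (hT (w k)) (hT (w j))
          (isPartition_seqJoin hT w hα k) hα
          (exists_subset_of_mem_seqJoin T w α (Finset.mem_range.1 hj))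
          (hc k j hcj.symm) hθ0 hθ1
        rw [← hn, mul_add] at this
        push_cast
        linarith
      · rw [Finset.card_insert_of_notMem hk]
        have := partEnt_refineBy_le_add_log_card μ (hT (w k)) (isPartition_seqJoin hT w hα k) hα
        push_cast
        linarith
  have hlogn : 0 ≤ Real.log n := Real.log_natCast_nonneg _
  have := seqEnt_le μ w (α := α) (C := N * Real.log n) (half_pos hε) fun k => by
    refine (hstep k).trans ?_
    gcongr
    simpa using Finset.card_le_univ ((Finset.range k).image c)
  linarith

end Entropy

section Compactness

attribute [local instance] Classical.propDecidable

variable {X : Type*} [MeasurableSpace X]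

/-- The class in `L²(μ)` of the indicator of `D` (zero if `D` is not measurable). -/
noncomputable def indL2 (μ : Measure X) [IsFiniteMeasure μ] (D : Set X) : Lp ℝ 2 μ :=
  if h : MeasurableSet D then indicatorConstLp 2 h (measure_ne_top μ D) 1 else 0

lemma inner_indL2 (μ : Measure X) [IsFiniteMeasure μ] {C D : Set X} (hC : MeasurableSet C)
    (hD : MeasurableSet D) : inner ℝ (indL2 μ C) (indL2 μ D) = μ.real (C ∩ D) := by
  rw [indL2, indL2, dif_pos hC, dif_pos hD, L2.inner_indicatorConstLp_indicatorConstLp]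
  simp

lemma measureReal_sdiff_le_norm_sq (μ : Measure X) [IsFiniteMeasure μ] {C D : Set X}
    (hC : MeasurableSet C) (hD : MeasurableSet D) :
    μ.real (C \ D) ≤ ‖indL2 μ C - indL2 μ D‖ ^ 2 := by
  rw [norm_sub_sq_real, ← real_inner_self_eq_norm_sq, ← real_inner_self_eq_norm_sq,
    inner_indL2 μ hC hC, inner_indL2 μ hC hD, inner_indL2 μ hD hD, inter_self, inter_self]
  have h1 := measureReal_inter_add_sdiff (μ := μ) (s := C) hD
  have h2 : μ.real (C ∩ D) ≤ μ.real D := measureReal_mono inter_subset_right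
  linarith

/-- The squared `L²`-distance from `1_C` to its conditional expectation on a finite partition. -/
lemma norm_sq_indL2_sub_sum (μ : Measure X) [IsFiniteMeasure μ] {P : Finset (Set X)}
    (hP : IsPartition P) {C : Set X} (hC : MeasurableSet C) :
    ‖indL2 μ C - ∑ D ∈ P, (μ.real (D ∩ C) / μ.real D) • indL2 μ D‖ ^ 2 =
      ∑ D ∈ P, (μ.real (D ∩ C) - μ.real (D ∩ C) ^ 2 / μ.real D) := by
  have h1 : inner ℝ (indL2 μ C) (∑ D ∈ P, (μ.real (D ∩ C) / μ.real D) • indL2 μ D) =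
      ∑ D ∈ P, μ.real (D ∩ C) ^ 2 / μ.real D := by
    rw [inner_sum]
    refine Finset.sum_congr rfl fun D hD => ?_
    rw [real_inner_smul_right, inner_indL2 μ hC (hP.1 D hD), inter_comm C D]
    ring
  have h2 : inner ℝ (∑ D ∈ P, (μ.real (D ∩ C) / μ.real D) • indL2 μ D)
      (∑ D ∈ P, (μ.real (D ∩ C) / μ.real D) • indL2 μ D) =
      ∑ D ∈ P, μ.real (D ∩ C) ^ 2 / μ.real D := by
    rw [sum_inner]
    refine Finset.sum_congr rfl fun D hD => ?_
    rw [inner_sum, Finset.sum_eq_single_of_mem D hD]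
    · rw [real_inner_smul_right, real_inner_smul_left, inner_indL2 μ (hP.1 D hD) (hP.1 D hD),
        inter_self]
      rcases eq_or_ne (μ.real D) 0 with h | h
      · simp [h]
      · field_simp
    · intro E hE hne
      rw [real_inner_smul_right, real_inner_smul_left, inner_indL2 μ (hP.1 D hD) (hP.1 E hE),
        (disjoint_iff_inter_eq_empty.1 (hP.2.1 hD hE hne.symm) : D ∩ E = ∅)]
      simp
  rw [norm_sub_sq_real, ← real_inner_self_eq_norm_sq, ← real_inner_self_eq_norm_sq, h1, h2,
    inner_indL2 μ hC hC, inter_self, Finset.sum_sub_distrib, hP.sum_measureReal_inter μ hC]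
  ring

variable {G : Type*}

lemma korbit_eq_image (μ : Measure X) [IsFiniteMeasure μ] {T : G → X → X}
    (hT : ∀ g, Measurable (T g)) (Λ : Set G) {B : Set X} (hB : MeasurableSet B) :
    korbit μ T Λ B = (fun g => indL2 μ (T g ⁻¹' B)) '' Λ := by
  have hae : ∀ g, (indL2 μ (T g ⁻¹' B) : X → ℝ) =ᵐ[μ]
      fun x => B.indicator (fun _ => (1 : ℝ)) (T g x) := by
    intro g
    rw [indL2, dif_pos (hT g hB)]
    exact indicatorConstLp_coeFn
  ext f
  constructor
  · rintro ⟨g, hg, hf⟩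
    exact ⟨g, hg, Lp.ext ((hae g).trans hf.symm)⟩
  · rintro ⟨g, hg, rfl⟩
    exact ⟨g, hg, hae g⟩

/-- If the orbit of `1_B` is not precompact then it stays away from all finite partitions. -/
lemma exists_le_sum_of_not_isCompact (μ : Measure X) [IsFiniteMeasure μ] {T : G → X → X}
    (hT : ∀ g, Measurable (T g)) {Λ : Set G} {B : Set X} (hB : MeasurableSet B)
    (hK : ¬ IsCompact (closure (korbit μ T Λ B))) :
    ∃ ε : ℝ, 0 < ε ∧ ∀ P : Finset (Set X), IsPartition P → ∃ g ∈ Λ,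
      ε ≤ ∑ D ∈ P, (μ.real (D ∩ T g ⁻¹' B) - μ.real (D ∩ T g ⁻¹' B) ^ 2 / μ.real D) := by
  by_contra! hcon
  apply hK
  refine isCompact_iff_totallyBounded_isComplete.2
    ⟨TotallyBounded.closure ?_, isClosed_closure.isComplete⟩
  rw [korbit_eq_image μ hT Λ hB, Metric.totallyBounded_iff]
  intro ε hε
  obtain ⟨P, hP, hlt⟩ := hcon ((ε / 2) ^ 2) (by positivity)
  have hcpt : IsCompact ((fun c : Set X → ℝ => ∑ D ∈ P, c D • indL2 μ D) ''
      (Set.univ.pi fun _ => Icc (0 : ℝ) 1)) := by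
    refine (isCompact_univ_pi fun _ => isCompact_Icc).image ?_
    fun_prop
  obtain ⟨t, ht, hcov⟩ := Metric.totallyBounded_iff.1 hcpt.totallyBounded (ε / 2) (half_pos hε)
  refine ⟨t, ht, ?_⟩
  rintro _ ⟨g, hg, rfl⟩
  have hnorm := hlt g hg
  rw [← norm_sq_indL2_sub_sum μ hP (hT g hB)] at hnorm
  have hnorm' := lt_of_pow_lt_pow_left₀ 2 (half_pos hε).le hnorm
  have hmem := hcov ⟨fun D => μ.real (D ∩ T g ⁻¹' B) / μ.real D, fun D _ =>
    ⟨div_nonneg measureReal_nonneg measureReal_nonneg,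
      div_le_one_of_le₀ (measureReal_mono inter_subset_left) measureReal_nonneg⟩, rfl⟩
  simp only [mem_iUnion, Metric.mem_ball, exists_prop] at hmem ⊢
  obtain ⟨y, hy, hdist⟩ := hmem
  refine ⟨y, hy, ?_⟩
  rw [← dist_eq_norm] at hnorm'
  exact (dist_triangle _ _ _).trans_lt (by linarith)

/-- Zero sequence entropy along all sequences in `Λ` forces precompact orbits. -/
lemma isCompact_closure_korbit_of_null (μ : Measure X) [IsProbabilityMeasure μ] {T : G → X → X}
    (hT : ∀ g, Measurable (T g)) {Λ : Set G}
    (hnull : ∀ w : ℕ → G, EnumIn w Λ → seqEntSup μ T w = 0) {B : Set X}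
    (hB : MeasurableSet B) : IsCompact (closure (korbit μ T Λ B)) := by
  by_contra hK
  obtain ⟨ε, hε, hex⟩ := exists_le_sum_of_not_isCompact μ hT hB hK
  choose F hF using hex
  have hα := isPartition_pairPart hB
  have hBα : B ∈ pairPart B := by simp [pairPart]
  let next : {P : Finset (Set X) // IsPartition P} → {P : Finset (Set X) // IsPartition P} :=
    fun P => ⟨refineBy (T (F P.1 P.2)) P.1 (pairPart B), P.2.refineBy (hT _) hα⟩
  let Q : ℕ → {P : Finset (Set X) // IsPartition P} :=
    fun k => next^[k] ⟨{univ}, isPartition_singleton_univ⟩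
  let w : ℕ → G := fun k => F (Q k).1 (Q k).2
  have hQ : ∀ k, seqJoin T w (pairPart B) k = (Q k).1 := by
    intro k
    induction k with
    | zero => rfl
    | succ k ih =>
      rw [seqJoin_succ, ih]
      simp only [Q, Function.iterate_succ_apply']
      rfl
  have hw : ∀ k, ε ≤ ∑ D ∈ seqJoin T w (pairPart B) k,
      (μ.real (D ∩ T (w k) ⁻¹' B) - μ.real (D ∩ T (w k) ⁻¹' B) ^ 2 / μ.real D) := by
    intro k
    rw [hQ k]
    exact (hF (Q k).1 (Q k).2).2
  have hne : ∀ j k, j < k → w j ≠ w k := by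
    intro j k hjk heq
    have h0 : ∑ D ∈ seqJoin T w (pairPart B) k,
        (μ.real (D ∩ T (w k) ⁻¹' B) - μ.real (D ∩ T (w k) ⁻¹' B) ^ 2 / μ.real D) = 0 := by
      refine Finset.sum_eq_zero fun D hD => ?_
      obtain ⟨A, hA, hsub⟩ := exists_subset_of_mem_seqJoin T w _ hjk D hD
      rw [heq] at hsub
      simp only [pairPart, Finset.mem_insert, Finset.mem_singleton] at hA
      rcases hA with rfl | rfl
      · rw [inter_eq_left.2 hsub, sq]
        rcases eq_or_ne (μ.real D) 0 with h | h
        · simp [h]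
        · field_simp
          simp
      · rw [preimage_compl, subset_compl_iff_disjoint_right, disjoint_iff_inter_eq_empty] at hsub
        simp [hsub]
    have := hw k
    linarith
  have hinj : Function.Injective w := by
    intro j k h
    rcases lt_trichotomy j k with hlt | heq | hlt
    · exact absurd h (hne j k hlt)
    · exact heq
    · exact absurd h.symm (hne k j hlt)
  have hzero := hnull w ⟨hinj, fun k => (hF (Q k).1 (Q k).2).1⟩
  have hle : seqEnt μ T w (pairPart B) ≤ 0 := by
    rw [seqEntSup, ENNReal.iSup_eq_zero] at hzero
    exact ENNReal.ofReal_eq_zero.1 (hzero ⟨_, hα⟩)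
  have hgrow : ∀ k : ℕ, k * ε ≤ partEnt μ (seqJoin T w (pairPart B) k) := by
    intro k
    induction k with
    | zero => simp [partEnt_seqJoin_zero]
    | succ k ih =>
      have := partEnt_add_le_partEnt_refineBy μ (hT (w k)) (isPartition_seqJoin hT w hα k) hα hBα
      rw [seqJoin_succ]
      have := hw k
      push_cast
      linarith
  have := le_seqEnt μ hT w hα hgrow
  linarith

/-- A precompact orbit takes finitely many values up to a small error in measure. -/
lemma exists_coloring_of_isCompact (μ : Measure X) [IsFiniteMeasure μ] {T : G → X → X}
    (hT : ∀ g, Measurable (T g)) {Λ : Set G} {B : Set X} (hB : MeasurableSet B)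
    (hK : IsCompact (closure (korbit μ T Λ B))) {δ : ℝ} (hδ : 0 < δ) :
    ∃ (N : ℕ) (c : Λ → Fin N), ∀ g h : Λ, c g = c h →
      μ.real (T h ⁻¹' B \ T g ⁻¹' B) ≤ δ := by
  have htb := hK.totallyBounded.subset subset_closure
  rw [korbit_eq_image μ hT Λ hB, Metric.totallyBounded_iff] at htb
  obtain ⟨t, ht, hcov⟩ := htb (√δ / 2) (by positivity)
  have hex : ∀ g : Λ, ∃ y : t, dist (indL2 μ (T g ⁻¹' B)) y < √δ / 2 := by
    intro g
    have := hcov ⟨g, g.2, rfl⟩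
    simp only [mem_iUnion, Metric.mem_ball, exists_prop] at this
    obtain ⟨y, hy, hd⟩ := this
    exact ⟨⟨y, hy⟩, hd⟩
  choose c hc using hex
  have := ht.to_subtype
  obtain ⟨N, ⟨e⟩⟩ := Finite.exists_equiv_fin t
  refine ⟨N, e ∘ c, fun g h hgh => ?_⟩
  have hgh' : c g = c h := e.injective hgh
  refine (measureReal_sdiff_le_norm_sq μ (hT h hB) (hT g hB)).trans ?_
  rw [← dist_eq_norm]
  have hg := hc g
  have hh := hc h
  rw [hgh'] at hg
  have hd : dist (indL2 μ (T h ⁻¹' B)) (indL2 μ (T g ⁻¹' B)) ≤ √δ := by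
    refine (dist_triangle_right _ _ (c h : Lp ℝ 2 μ)).trans ?_
    linarith
  calc _ ≤ √δ ^ 2 := by gcongr
    _ = δ := Real.sq_sqrt hδ.le

end Compactness

section Tube

variable {q : ℕ} [NeZero q]

/-- A tube of any width is covered by finitely many translates of the unit tube. -/
lemma exists_finite_translates_lamQ {β : Fin q → ℝ} (hβ : β 0 = 1) (b : Fin q → ℝ) :
    ∃ F : Set (Fin q → ℤ), F.Finite ∧
      ∀ w ∈ LamQ β b, ∃ v ∈ LamQ β fun _ => 1, ∃ u ∈ F, w = u + v := by
  refine ⟨Icc (fun i => -(⌈|b i|⌉ + 1)) (fun i => ⌈|b i|⌉ + 1), finite_Icc _ _, fun w hw => ?_⟩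
  set v : Fin q → ℤ := fun i => round (β i * (w 0 : ℝ)) with hv
  have hv0 : v 0 = w 0 := by simp [hv, hβ]
  have hround : ∀ i, |β i * (w 0 : ℝ) - v i| ≤ 1 / 2 := fun i => abs_sub_round _
  have hbound : ∀ i, |((w i - v i : ℤ) : ℝ)| ≤ ((⌈|b i|⌉ + 1 : ℤ) : ℝ) := by
    intro i
    have hceil := Int.le_ceil |b i|
    have habs := abs_nonneg (b i)
    rcases eq_or_ne i 0 with rfl | hi
    · rw [hv0, sub_self]
      push_cast
      rw [abs_zero]
      linarith
    · obtain ⟨h1, h2⟩ := hw i hi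
      obtain ⟨h3, h4⟩ := abs_le.1 (hround i)
      have := le_abs_self (b i)
      push_cast
      rw [abs_le]
      constructor <;> linarith
  refine ⟨v, fun i hi => ?_, w - v, ⟨fun i => ?_, fun i => ?_⟩, (sub_add_cancel w v).symm⟩
  · obtain ⟨h3, h4⟩ := abs_le.1 (hround i)
    rw [hv0]
    constructor <;> linarith
  · exact_mod_cast (abs_le.1 (hbound i)).1
  · exact_mod_cast (abs_le.1 (hbound i)).2

variable {X : Type*} [MeasurableSpace X]

/-- Under directional discrete spectrum, the pullbacks of a measurable set along a tube of any
width take finitely many values up to a small error in measure. -/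
lemma exists_coloring_lamQ (μ : Measure X) [IsFiniteMeasure μ] {T : (Fin q → ℤ) → X → X}
    (hT : ∀ g, Measurable (T g)) (hadd : ∀ v w, T (v + w) = T v ∘ T w) {β : Fin q → ℝ}
    (hβ : β 0 = 1) (hds : dirKronQ μ T β (fun _ => 1) = {B : Set X | MeasurableSet B})
    (b : Fin q → ℝ) {B : Set X} (hB : MeasurableSet B) {δ : ℝ} (hδ : 0 < δ) :
    ∃ (N : ℕ) (c : LamQ β b → Fin N), ∀ g h : LamQ β b, c g = c h →
      μ.real (T h ⁻¹' B \ T g ⁻¹' B) ≤ δ := by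
  obtain ⟨F, hFfin, hF⟩ := exists_finite_translates_lamQ hβ b
  choose! v hv u hu hw using hF
  have hcol : ∀ u : Fin q → ℤ, _ := fun u => by
    have hmem : T u ⁻¹' B ∈ dirKronQ μ T β (fun _ => 1) := by rw [hds]; exact hT u hB
    exact exists_coloring_of_isCompact μ hT hmem.1 hmem.2 hδ
  choose N c hc using hcol
  have := hFfin.to_subtype
  obtain ⟨M, ⟨e⟩⟩ := Finite.exists_equiv_fin (F × ∀ u : F, Fin (N u))
  refine ⟨M, fun g => e (⟨u g, hu g g.2⟩, fun u => c u ⟨v g, hv g g.2⟩), fun g h hgh => ?_⟩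
  obtain ⟨h1, h2⟩ := Prod.mk.inj (e.injective hgh)
  have h1' : u g = u h := congrArg Subtype.val h1
  have h3 := hc (u h) ⟨v g, hv g g.2⟩ ⟨v h, hv h h.2⟩ (congrFun h2 ⟨u h, hu h h.2⟩)
  have hpre : ∀ g : LamQ β b, T g ⁻¹' B = T (v g) ⁻¹' (T (u g) ⁻¹' B) := fun g => by
    rw [← preimage_comp, ← hadd, ← hw g g.2]
  rw [hpre g, hpre h, h1']
  exact h3

end Tube

/-- a `ℤ^q`-system has `v`-discrete spectrum iff it is `v`-null. -/
theorem dirDiscreteSpectrumQ_iff_dirNullQ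
    {X : Type*} [MetricSpace X] [CompactSpace X] [MeasurableSpace X] [BorelSpace X]
    (q : ℕ) [NeZero q] (hq : 2 ≤ q)
    (μ : Measure X) [IsProbabilityMeasure μ] (T : (Fin q → ℤ) → X → X)
    (hT : IsZqMPS μ T) (β : Fin q → ℝ) (hβ : β 0 = 1) :
    dirKronQ μ T β (fun _ => 1) = {B : Set X | MeasurableSet B} ↔
      ∀ b : Fin q → ℝ, (∀ i : Fin q, i ≠ 0 → 0 < b i) →
        ∀ w : ℕ → Fin q → ℤ, EnumIn w (LamQ β b) → seqEntSup μ T w = 0 := by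
  obtain ⟨hcont, -, hadd, -⟩ := hT
  have hmeas : ∀ g, Measurable (T g) := fun g => (hcont g).measurable
  constructor
  · intro hds b _ w hw
    rw [seqEntSup, ENNReal.iSup_eq_zero]
    rintro ⟨α, hα⟩
    refine ENNReal.ofReal_eq_zero.2 (seqEnt_nonpos_of_coloring μ hmeas w hα fun δ hδ => ?_)
    have hex : ∀ A : α, _ := fun A =>
      exists_coloring_lamQ μ hmeas hadd hβ hds b (hα.1 A A.2) hδ
    choose N c hc using hex
    obtain ⟨M, ⟨e⟩⟩ := Finite.exists_equiv_fin (∀ A : α, Fin (N A))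
    refine ⟨M, fun i => e fun A => c A ⟨w i, hw.2 i⟩, fun i j hij A hA => ?_⟩
    exact hc ⟨A, hA⟩ _ _ (congrFun (e.injective hij) ⟨A, hA⟩)
  · intro hnull
    ext B
    refine ⟨fun hB => hB.1, fun hB => ⟨hB, ?_⟩⟩
    exact isCompact_closure_korbit_of_null μ hmeas
      (hnull (fun _ => 1) fun _ _ => one_pos) hB

end Directional
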